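/- arXiv:2207.03645 — 4 statements merged into one kernel-verified Lean document; each statement's English description precedes it below -/
import Mathlib

section
/- For every nonidentity element g of G one has ind(g) ≥ 2; moreover ind(g) = 2 if and only if g is one of the four elements (1 2 3), (1 3 2), (4 5 6), (4 6 5), and each of these four elements has order 3. -/
/-- The 3-cycle (1 2 3) of S₆, acting on `Fin 6` as the cycle 0 → 1 → 2 → 0. -/
def g₁ : Equiv.Perm (Fin 6) := List.formPerm [0, 1, 2]

/-- The 3-cycle (1 3 2) of S₆. -/
def g₁' : Equiv.Perm (Fin 6) := List.formPerm [0, 2, 1]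

/-- The 3-cycle (4 5 6) of S₆, acting on `Fin 6` as the cycle 3 → 4 → 5 → 3. -/
def g₂ : Equiv.Perm (Fin 6) := List.formPerm [3, 4, 5]

/-- The 3-cycle (4 6 5) of S₆. -/
def g₂' : Equiv.Perm (Fin 6) := List.formPerm [3, 5, 4]

/-- The involution (1 4)(2 5)(3 6) of S₆. -/
def g₃ : Equiv.Perm (Fin 6) :=
  Equiv.swap 0 3 * Equiv.swap 1 4 * Equiv.swap 2 5

/-- Klüners' group `G = C₃ ≀ C₂ ≤ S₆`, generated by (1 2 3), (4 5 6) and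
(1 4)(2 5)(3 6). -/
def G : Subgroup (Equiv.Perm (Fin 6)) := Subgroup.closure {g₁, g₂, g₃}

/-- The index `ind g = 6 - #{orbits of ⟨g⟩ on {1,…,6}}` of a permutation in S₆. -/
noncomputable def ind (g : Equiv.Perm (Fin 6)) : ℕ :=
  6 - Nat.card (MulAction.orbitRel.Quotient (Subgroup.zpowers g) (Fin 6))

instance (g : Equiv.Perm (Fin 6)) : DecidableRel (Equiv.Perm.SameCycle.setoid g) :=
  inferInstanceAs (DecidableRel g.SameCycle)

/-- The orbits of `⟨g⟩` are the classes of the relation `g.SameCycle`. -/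
lemma ind_eq_card_quotient_sameCycle (g : Equiv.Perm (Fin 6)) :
    ind g = 6 - Fintype.card (Quotient (Equiv.Perm.SameCycle.setoid g)) := by
  have h : MulAction.orbitRel (Subgroup.zpowers g) (Fin 6) = Equiv.Perm.SameCycle.setoid g := by
    ext x y
    rw [show Equiv.Perm.SameCycle.setoid g x y ↔ g.SameCycle y x from Equiv.Perm.sameCycle_comm]
    simp [MulAction.orbitRel_apply, MulAction.mem_orbit_iff, Equiv.Perm.SameCycle,
      Subgroup.smul_def]
  rw [ind, MulAction.orbitRel.Quotient, h, Nat.card_eq_fintype_card]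

/-- Every element of `G` has the normal form `g₁ ^ a * g₂ ^ b * g₃ ^ c`. -/
lemma exists_eq_pow_mul_pow_mul_pow {g : Equiv.Perm (Fin 6)} (hg : g ∈ G) :
    ∃ (a b : Fin 3) (c : Fin 2), g = g₁ ^ a.val * g₂ ^ b.val * g₃ ^ c.val := by
  induction hg using Subgroup.closure_induction_left with
  | one => exact ⟨0, 0, 0, by simp⟩
  | mul_left x hx y hy ih =>
    clear hy
    obtain ⟨a, b, c, rfl⟩ := ih
    rcases hx with rfl | rfl | rfl <;> revert a b c <;> decide +kernel
  | inv_mul_cancel x hx y hy ih =>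
    clear hy
    obtain ⟨a, b, c, rfl⟩ := ih
    rcases hx with rfl | rfl | rfl <;> revert a b c <;> decide +kernel

/-- Every nonidentity element of Klüners' group has index at least 2, the
elements of index exactly 2 are precisely (1 2 3), (1 3 2), (4 5 6), (4 6 5),
and each of these four elements has order 3. -/
theorem index_two_elements :
    (∀ g ∈ G, g ≠ 1 → 2 ≤ ind g) ∧
    (∀ g ∈ G, g ≠ 1 → (ind g = 2 ↔ g = g₁ ∨ g = g₁' ∨ g = g₂ ∨ g = g₂')) ∧
    orderOf g₁ = 3 ∧ orderOf g₁' = 3 ∧ orderOf g₂ = 3 ∧ orderOf g₂' = 3 := by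
  refine ⟨fun g hg hne => ?_, fun g hg hne => ?_, ?_, ?_, ?_, ?_⟩
  · obtain ⟨a, b, c, rfl⟩ := exists_eq_pow_mul_pow_mul_pow hg
    clear hg
    rw [ind_eq_card_quotient_sameCycle]
    revert a b c
    decide +kernel
  · obtain ⟨a, b, c, rfl⟩ := exists_eq_pow_mul_pow_mul_pow hg
    clear hg
    rw [ind_eq_card_quotient_sameCycle]
    revert a b c
    decide +kernel
  all_goals exact orderOf_eq_prime (by decide) (by decide)
end

section
/- In G, the element (1 2 3) is conjugate to (4 5 6) and the element (1 3 2) is conjugate to (4 6 5) (by elements of G), but (1 2 3) is not conjugate to (1 3 2) by any element of G; hence the four index-2 elements form exactly two G-conjugacy classes, namely {(1 2 3), (4 5 6)} and {(1 3 2), (4 6 5)}. -/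
theorem conj_g₃_g₁ : g₃ * g₁ * g₃⁻¹ = g₂ := by decide

theorem conj_g₃_g₂ : g₃ * g₂ * g₃⁻¹ = g₁ := by decide

theorem commute_g₁_g₂ : Commute g₁ g₂ := by
  unfold Commute SemiconjBy
  decide

theorem g₁'_eq_inv : g₁' = g₁⁻¹ := by decide

theorem g₂'_eq_inv : g₂' = g₂⁻¹ := by decide

theorem g₃_mem_G : g₃ ∈ G := Subgroup.subset_closure (by simp)

theorem G_le_normalizer : G ≤ Subgroup.normalizer ({g₁, g₂} : Set (Equiv.Perm (Fin 6))) := by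
  refine (Subgroup.closure_le _).2 fun w hw => Subgroup.mem_normalizer_fintype fun g hg => ?_
  have h₁₂ : g₁ * g₂ * g₁⁻¹ = g₂ := by rw [commute_g₁_g₂.eq, mul_inv_cancel_right]
  have h₂₁ : g₂ * g₁ * g₂⁻¹ = g₁ := by rw [← commute_g₁_g₂.eq, mul_inv_cancel_right]
  rcases hw with rfl | rfl | rfl <;> rcases hg with rfl | rfl <;>
    simp [h₁₂, h₂₁, conj_g₃_g₁, conj_g₃_g₂]

theorem mem_pair_iff_of_conj {w g h : Equiv.Perm (Fin 6)} (hw : w ∈ G) (hc : w * g * w⁻¹ = h) :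
    g ∈ ({g₁, g₂} : Set (Equiv.Perm (Fin 6))) ↔ h ∈ ({g₁, g₂} : Set (Equiv.Perm (Fin 6))) :=
  hc ▸ Subgroup.mem_set_normalizer_iff.1 (G_le_normalizer hw) g

theorem inv_g₁_notMem_pair : g₁⁻¹ ∉ ({g₁, g₂} : Set (Equiv.Perm (Fin 6))) := by
  simp only [Set.mem_insert_iff, Set.mem_singleton_iff]
  decide

theorem mem_inv_pair_of_notMem_pair {g : Equiv.Perm (Fin 6)}
    (hg : g ∈ ({g₁, g₁⁻¹, g₂, g₂⁻¹} : Set (Equiv.Perm (Fin 6))))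
    (hg' : g ∉ ({g₁, g₂} : Set (Equiv.Perm (Fin 6)))) :
    g ∈ ({g₁⁻¹, g₂⁻¹} : Set (Equiv.Perm (Fin 6))) := by
  rcases hg with rfl | rfl | rfl | rfl
  · exact absurd (.inl rfl) hg'
  · exact .inl rfl
  · exact absurd (.inr rfl) hg'
  · exact .inr rfl

theorem exists_conj_of_mem_pair {g h : Equiv.Perm (Fin 6)}
    (hg : g ∈ ({g₁, g₂} : Set (Equiv.Perm (Fin 6))))
    (hh : h ∈ ({g₁, g₂} : Set (Equiv.Perm (Fin 6)))) : ∃ w ∈ G, w * g * w⁻¹ = h := by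
  rcases hg with rfl | rfl <;> rcases hh with rfl | rfl
  · exact ⟨1, G.one_mem, by simp⟩
  · exact ⟨g₃, g₃_mem_G, conj_g₃_g₁⟩
  · exact ⟨g₃, g₃_mem_G, conj_g₃_g₂⟩
  · exact ⟨1, G.one_mem, by simp⟩

theorem exists_conj_of_inv_mem_pair {g h : Equiv.Perm (Fin 6)}
    (hg : g⁻¹ ∈ ({g₁, g₂} : Set (Equiv.Perm (Fin 6))))
    (hh : h⁻¹ ∈ ({g₁, g₂} : Set (Equiv.Perm (Fin 6)))) : ∃ w ∈ G, w * g * w⁻¹ = h := by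
  obtain ⟨w, hw, hc⟩ := exists_conj_of_mem_pair hg hh
  exact ⟨w, hw, inv_injective (by rw [← hc]; group)⟩

/-- In Klüners' group G, (1 2 3) is conjugate to (4 5 6) and (1 3 2) is
conjugate to (4 6 5), but (1 2 3) is not conjugate to (1 3 2); the four
index-2 elements form exactly the two G-conjugacy classes
{(1 2 3), (4 5 6)} and {(1 3 2), (4 6 5)}. -/
theorem conjugacy_classes_of_index_two_elements :
    (∃ w ∈ G, w * g₁ * w⁻¹ = g₂) ∧
    (∃ w ∈ G, w * g₁' * w⁻¹ = g₂') ∧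
    ¬ (∃ w ∈ G, w * g₁ * w⁻¹ = g₁') ∧
    (∀ g ∈ ({g₁, g₁', g₂, g₂'} : Set (Equiv.Perm (Fin 6))),
      ∀ h ∈ ({g₁, g₁', g₂, g₂'} : Set (Equiv.Perm (Fin 6))),
        ((∃ w ∈ G, w * g * w⁻¹ = h) ↔
          ((g ∈ ({g₁, g₂} : Set (Equiv.Perm (Fin 6))) ∧
            h ∈ ({g₁, g₂} : Set (Equiv.Perm (Fin 6)))) ∨
           (g ∈ ({g₁', g₂'} : Set (Equiv.Perm (Fin 6))) ∧
            h ∈ ({g₁', g₂'} : Set (Equiv.Perm (Fin 6))))))) := by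
  rw [g₁'_eq_inv, g₂'_eq_inv]
  refine ⟨exists_conj_of_mem_pair (by simp) (by simp),
    exists_conj_of_inv_mem_pair (by simp) (by simp), ?_, fun g hg h hh => ⟨?_, ?_⟩⟩
  · rintro ⟨w, hw, hc⟩
    exact inv_g₁_notMem_pair ((mem_pair_iff_of_conj hw hc).1 (by simp))
  · rintro ⟨w, hw, hc⟩
    have hiff := mem_pair_iff_of_conj hw hc
    by_cases hg' : g ∈ ({g₁, g₂} : Set (Equiv.Perm (Fin 6)))
    · exact .inl ⟨hg', hiff.1 hg'⟩
    · exact .inr ⟨mem_inv_pair_of_notMem_pair hg hg',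
        mem_inv_pair_of_notMem_pair hh (mt hiff.2 hg')⟩
  · rintro (⟨hg, hh⟩ | ⟨hg, hh⟩)
    · exact exists_conj_of_mem_pair hg hh
    · refine exists_conj_of_inv_mem_pair ?_ ?_
      · rcases hg with rfl | rfl <;> simp
      · rcases hh with rfl | rfl <;> simp
end

section
/- The subgroup N of G generated by (1 2 3) and (4 5 6) has order 9, is a normal subgroup of G, and is the unique Sylow 3-subgroup of G. -/
lemma g₁_mem : g₁ ∈ G := Subgroup.subset_closure (by simp)

lemma g₂_mem : g₂ ∈ G := Subgroup.subset_closure (by simp)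

/-- The subgroup N of G generated by (1 2 3) and (4 5 6). -/
def N : Subgroup G := Subgroup.closure {⟨g₁, g₁_mem⟩, ⟨g₂, g₂_mem⟩}

lemma exists_eq_of_mem_closure_pair {σ : Equiv.Perm (Fin 6)}
    (hσ : σ ∈ Subgroup.closure {g₁, g₂}) :
    ∃ i j : Fin 3, σ = g₁ ^ (i : ℕ) * g₂ ^ (j : ℕ) := by
  induction hσ using Subgroup.closure_induction_left with
  | one => exact ⟨0, 0, by simp⟩
  | mul_left x hx y _ ih =>
    obtain ⟨i, j, rfl⟩ := ih
    obtain hx | hx := hx <;> rw [hx] <;> clear * - <;> revert i j <;> decide +kernel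
  | inv_mul_cancel x hx y _ ih =>
    obtain ⟨i, j, rfl⟩ := ih
    obtain hx | hx := hx <;> rw [hx] <;> clear * - <;> revert i j <;> decide +kernel

lemma exists_eq_of_mem_G {σ : Equiv.Perm (Fin 6)} (hσ : σ ∈ G) :
    ∃ (i j : Fin 3) (k : Fin 2), σ = g₁ ^ (i : ℕ) * g₂ ^ (j : ℕ) * g₃ ^ (k : ℕ) := by
  induction hσ using Subgroup.closure_induction_left with
  | one => exact ⟨0, 0, 0, by simp⟩
  | mul_left x hx y _ ih =>
    obtain ⟨i, j, k, rfl⟩ := ih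
    obtain hx | hx | hx := hx <;> rw [hx] <;> clear * - <;> revert i j k <;> decide +kernel
  | inv_mul_cancel x hx y _ ih =>
    obtain ⟨i, j, k, rfl⟩ := ih
    obtain hx | hx | hx := hx <;> rw [hx] <;> clear * - <;> revert i j k <;> decide +kernel

lemma map_subtype_N : N.map G.subtype = Subgroup.closure {g₁, g₂} := by
  rw [N, MonoidHom.map_closure, Set.image_pair]
  rfl

lemma mem_N_iff {x : G} :
    x ∈ N ↔ ∃ i j : Fin 3, (x : Equiv.Perm (Fin 6)) = g₁ ^ (i : ℕ) * g₂ ^ (j : ℕ) := by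
  rw [← Subgroup.mem_map_iff_mem G.subtype_injective, map_subtype_N, Subgroup.coe_subtype]
  refine ⟨exists_eq_of_mem_closure_pair, ?_⟩
  rintro ⟨i, j, h⟩
  rw [h]
  exact mul_mem (pow_mem (Subgroup.subset_closure (by simp)) _)
    (pow_mem (Subgroup.subset_closure (by simp)) _)

lemma card_N : Nat.card N = 9 := by
  let f : Fin 3 × Fin 3 → N := fun p =>
    ⟨⟨g₁ ^ (p.1 : ℕ) * g₂ ^ (p.2 : ℕ), mul_mem (pow_mem g₁_mem _) (pow_mem g₂_mem _)⟩,
      mem_N_iff.2 ⟨p.1, p.2, rfl⟩⟩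
  have hinj : ∀ p q : Fin 3 × Fin 3,
      g₁ ^ (p.1 : ℕ) * g₂ ^ (p.2 : ℕ) = g₁ ^ (q.1 : ℕ) * g₂ ^ (q.2 : ℕ) → p = q := by
    decide +kernel
  have hf : Function.Bijective f := by
    refine ⟨fun p q h => hinj p q (congrArg (fun x : N => ((x : G) : Equiv.Perm (Fin 6))) h), ?_⟩
    rintro ⟨x, hx⟩
    obtain ⟨i, j, h⟩ := mem_N_iff.1 hx
    exact ⟨(i, j), Subtype.ext (Subtype.ext h.symm)⟩
  rw [← Nat.card_eq_of_bijective f hf]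
  simp

lemma normal_N : N.Normal := by
  have hconj : ∀ (a b : Fin 3) (k : Fin 2) (i j : Fin 3), ∃ i' j' : Fin 3,
      g₁ ^ (a : ℕ) * g₂ ^ (b : ℕ) * g₃ ^ (k : ℕ) * (g₁ ^ (i : ℕ) * g₂ ^ (j : ℕ)) *
        (g₁ ^ (a : ℕ) * g₂ ^ (b : ℕ) * g₃ ^ (k : ℕ))⁻¹ =
      g₁ ^ (i' : ℕ) * g₂ ^ (j' : ℕ) := by
    decide +kernel
  refine ⟨fun n hn x => ?_⟩
  obtain ⟨i, j, hn⟩ := mem_N_iff.1 hn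
  obtain ⟨a, b, k, hx⟩ := exists_eq_of_mem_G x.2
  rw [mem_N_iff]
  simpa only [Subgroup.coe_mul, Subgroup.coe_inv, hn, hx] using hconj a b k i j

lemma sq_mem_N (x : G) : x ^ 2 ∈ N := by
  have hsq : ∀ (a b : Fin 3) (k : Fin 2), ∃ i j : Fin 3,
      (g₁ ^ (a : ℕ) * g₂ ^ (b : ℕ) * g₃ ^ (k : ℕ)) ^ 2 = g₁ ^ (i : ℕ) * g₂ ^ (j : ℕ) := by
    decide +kernel
  obtain ⟨a, b, k, hx⟩ := exists_eq_of_mem_G x.2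
  rw [mem_N_iff]
  simpa only [Subgroup.coe_pow, hx] using hsq a b k

lemma le_N_of_isPGroup {P : Subgroup G} (hP : IsPGroup 3 P) : P ≤ N := by
  intro x hx
  obtain ⟨k, hk⟩ := hP ⟨x, hx⟩
  have hk : x ^ 3 ^ k = 1 := congrArg Subtype.val hk
  obtain ⟨m, hm⟩ : Odd (3 ^ k) := Odd.pow (by decide)
  have hx' : x = (x ^ 2) ^ (m + 1) := by
    rw [← pow_mul, mul_add, mul_one, ← add_assoc _ 1 1, ← hm, pow_succ, hk, one_mul]
  rw [hx']
  exact pow_mem (sq_mem_N x) _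

/-- The subgroup N = ⟨(1 2 3), (4 5 6)⟩ of Klüners' group G has order 9, is
normal in G, and is the unique Sylow 3-subgroup of G. -/
theorem N_is_unique_sylow_three_subgroup :
    Nat.card N = 9 ∧ N.Normal ∧ ∀ P : Sylow 3 G, (P : Subgroup G) = N :=
  ⟨card_N, normal_N, fun P =>
    (P.is_maximal' (IsPGroup.of_card (n := 2) card_N) (le_N_of_isPGroup P.isPGroup')).symm⟩
end

section
/- Let a₀,…,a_n be positive integers and let r be a rational number with 0 < r < 1. Then r·(a₀ + ⋯ + a_n) + Σ_{j=0}^n fract(−aⱼ·r) = Σ_{j=0}^n ⌈aⱼ·r⌉, each summand satisfies ⌈aⱼ·r⌉ ≥ 1, and hence Σ_{j=0}^n ⌈aⱼ·r⌉ ≥ n + 1; in particular, if n ≥ 1 then Σ_{j=0}^n ⌈aⱼ·r⌉ ≥ 2. -/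
/-- Computation for the weighted projective stack 𝒫(a₀,…,aₙ) with the
quasi-toric raising function: for positive integers a₀,…,aₙ and a rational
0 < r < 1, one has r·(a₀+⋯+aₙ) + Σⱼ {−aⱼ·r} = Σⱼ ⌈aⱼ·r⌉, each ⌈aⱼ·r⌉ ≥ 1,
hence Σⱼ ⌈aⱼ·r⌉ ≥ n + 1, and in particular Σⱼ ⌈aⱼ·r⌉ ≥ 2 when n ≥ 1. -/
theorem age_c_weighted_projective_stack (n : ℕ) (a : Fin (n + 1) → ℕ)
    (ha : ∀ j, 0 < a j) (r : ℚ) (hr0 : 0 < r) (hr1 : r < 1) :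
    r * (∑ j, (a j : ℚ)) + ∑ j, Int.fract (-(a j : ℚ) * r) =
      ((∑ j, ⌈(a j : ℚ) * r⌉ : ℤ) : ℚ) ∧
    (∀ j, 1 ≤ ⌈(a j : ℚ) * r⌉) ∧
    ((n : ℤ) + 1 ≤ ∑ j, ⌈(a j : ℚ) * r⌉) ∧
    (1 ≤ n → (2 : ℤ) ≤ ∑ j, ⌈(a j : ℚ) * r⌉) := by
  have one_le : ∀ j, 1 ≤ ⌈(a j : ℚ) * r⌉ := fun j =>
    Int.one_le_ceil_iff.2 (mul_pos (Nat.cast_pos.2 (ha j)) hr0)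
  have le_sum : (n : ℤ) + 1 ≤ ∑ j, ⌈(a j : ℚ) * r⌉ := by
    simpa using Finset.card_nsmul_le_sum Finset.univ _ 1 fun j _ => one_le j
  refine ⟨?_, one_le, le_sum, fun hn => by lia⟩
  rw [Finset.mul_sum, ← Finset.sum_add_distrib, Int.cast_sum]
  refine Finset.sum_congr rfl fun j _ => ?_
  rw [neg_mul, Int.fract, Int.floor_neg]
  push_cast
  ring
end
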